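/- Suppose Assumptions 1 and 3 hold, only Y is mismeasured (Z'=Z and D'=D almost surely), the measurement error of Y is non-differential with respect to the potential values (Y' is independent of (Z, D_1, D_0, Y_1, Y_0) given Y), all conditioning events have positive probability, P(U=c) > 0, P(U=n) > 0, r_Y > 0, and CACE' := [P(Y'=1|Z=1) − P(Y'=1|Z=0)] / P(D=1|Z=1) ≥ 0. Define N_Y^m = min{ P(Y'=1|D=0,Z=1), P(Y'=1|D=1,Z=1) − CACE' } and M_Y^m = max{ P(Y'=1|D=0,Z=1), P(Y'=1|D=1,Z=1) }. Then SP_Y ≥ 1 − N_Y^m, SN_Y ≥ M_Y^m, and the bounds CACE' ≤ CACE and CACE × (M_Y^m − N_Y^m) ≤ CACE' hold, where CACE = E(Y_1 − Y_0 | U=c). -/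

import Mathlib

open MeasureTheory ProbabilityTheory

noncomputable def pr {Ω : Type*} [MeasurableSpace Ω] (μ : MeasureTheory.Measure Ω)
    (A : Set Ω) : ℝ := (μ A).toReal

noncomputable def cpr {Ω : Type*} [MeasurableSpace Ω] (μ : MeasureTheory.Measure Ω)
    (B A : Set Ω) : ℝ := (ProbabilityTheory.cond μ B A).toReal

def bin01 : Set ℝ := {0, 1}

theorem cpr_eq_div {Ω : Type*} [MeasurableSpace Ω] (μ : Measure Ω) {B : Set Ω}
    (hB : MeasurableSet B) (A : Set Ω) : cpr μ B A = μ.real (B ∩ A) / μ.real B := by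
  rw [cpr, cond_apply hB, ENNReal.toReal_mul, ENNReal.toReal_inv, inv_mul_eq_div]
  rfl

theorem cpr_congr_ae {Ω : Type*} [MeasurableSpace Ω] (μ : Measure Ω) {B C : Set Ω}
    (hBC : B =ᵐ[μ] C) (A : Set Ω) : cpr μ B A = cpr μ C A := by
  rw [cpr, cpr, ProbabilityTheory.cond, ProbabilityTheory.cond, measure_congr hBC,
    Measure.restrict_congr_set hBC]

theorem measureReal_eq_add_of_binary {Ω : Type*} [MeasurableSpace Ω] (μ : Measure Ω)
    [IsFiniteMeasure μ] {X : Ω → ℝ} (hX : Measurable X) (hb : ∀ ω, X ω = 0 ∨ X ω = 1)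
    (A : Set Ω) : μ.real A = μ.real (A ∩ {ω | X ω = 0}) + μ.real (A ∩ {ω | X ω = 1}) := by
  have hdiff : A \ {ω | X ω = 0} = A ∩ {ω | X ω = 1} := by
    ext ω
    rcases hb ω with h | h <;> simp [h]
  rw [← hdiff]
  exact (measureReal_inter_add_sdiff (hX (measurableSet_singleton 0))).symm

theorem measureReal_inter_eq_mul_of_binary {Ω : Type*} [MeasurableSpace Ω] (μ : Measure Ω)
    [IsFiniteMeasure μ] {X : Ω → ℝ} (hX : Measurable X) (hb : ∀ ω, X ω = 0 ∨ X ω = 1)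
    {A S : Set Ω} {e : ℝ}
    (h : ∀ x ∈ bin01, μ.real (A ∩ {ω | X ω = x} ∩ S) = e * μ.real (A ∩ {ω | X ω = x})) :
    μ.real (A ∩ S) = e * μ.real A := by
  rw [measureReal_eq_add_of_binary μ hX hb (A ∩ S), measureReal_eq_add_of_binary μ hX hb A,
    Set.inter_right_comm, Set.inter_right_comm A S, h 0 (by simp [bin01]),
    h 1 (by simp [bin01]), mul_add]

theorem integral_binary {Ω : Type*} [MeasurableSpace Ω] (ν : Measure Ω)
    {X : Ω → ℝ} (hX : Measurable X) (hb : ∀ ω, X ω = 0 ∨ X ω = 1) :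
    ∫ ω, X ω ∂ν = ν.real {ω | X ω = 1} := by
  have hind : X = Set.indicator {ω | X ω = 1} 1 := by
    ext ω
    rcases hb ω with h | h <;> simp [h]
  conv_lhs => rw [hind]
  exact integral_indicator_one (hX (measurableSet_singleton 1))

theorem integrable_binary {Ω : Type*} [MeasurableSpace Ω] (ν : Measure Ω) [IsFiniteMeasure ν]
    {X : Ω → ℝ} (hX : Measurable X) (hb : ∀ ω, X ω = 0 ∨ X ω = 1) : Integrable X ν :=
  Integrable.of_bound hX.aestronglyMeasurable 1
    (ae_of_all _ fun ω => by rcases hb ω with h | h <;> simp [h])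

/-- The bounds in terms of `p = P(U = c)`, `q = P(U = n)`, the false positive rate `f`, the
sensitivity `s`, and the joint probabilities `a`, `b` of a positive outcome and complier status
under the two assignments, `c` being that of a positive outcome and never-taker status. -/
theorem cace_bounds {p q f s a b c : ℝ} (hp : 0 < p) (hq : 0 < q) (hs : s ≤ 1) (hf : 0 ≤ f)
    (hr : 0 < s - f) (ha : a ≤ p) (hb : 0 ≤ b) (hc : 0 ≤ c) (hcq : c ≤ q)
    {cace cace' M N : ℝ} (hcace : cace = a / p - b / p) (hcace' : cace' = (s - f) * cace)
    (hpos : 0 ≤ cace')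
    (hN : N = min (f + (s - f) * (c / q)) (f + (s - f) * (a / p) - cace'))
    (hM : M = max (f + (s - f) * (c / q)) (f + (s - f) * (a / p))) :
    f ≤ N ∧ M ≤ s ∧ cace' ≤ cace ∧ cace * (M - N) ≤ cace' := by
  have hcace0 : 0 ≤ cace := by
    rw [hcace'] at hpos
    exact nonneg_of_mul_nonneg_right hpos hr
  have hap : a / p ≤ 1 := (div_le_one hp).2 ha
  have hcq1 : c / q ≤ 1 := (div_le_one hq).2 hcq
  have hbp : 0 ≤ b / p := by positivity
  have hcq0 : 0 ≤ c / q := by positivity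
  have hfN : f ≤ N := by
    rw [hN, hcace', hcace]
    refine le_min ?_ ?_ <;> nlinarith
  have hMs : M ≤ s := by
    rw [hM]
    refine max_le ?_ ?_ <;> nlinarith
  exact ⟨hfN, hMs, by nlinarith, by nlinarith⟩

set_option maxHeartbeats 1000000 in
theorem stmt13 {Ω : Type*} [MeasurableSpace Ω]
    (μ : MeasureTheory.Measure Ω) [IsProbabilityMeasure μ]
    (Z D Y Y' D1 D0 Y1 Y0 : Ω → ℝ)
    (h_meas_Z : Measurable Z)
    (h_meas_D : Measurable D)
    (h_meas_Y : Measurable Y)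
    (h_meas_Yp : Measurable Y')
    (h_meas_D1 : Measurable D1)
    (h_meas_D0 : Measurable D0)
    (h_meas_Y1 : Measurable Y1)
    (h_meas_Y0 : Measurable Y0)
    (h_bin_Z : ∀ ω, Z ω = 0 ∨ Z ω = 1)
    (h_bin_Yp : ∀ ω, Y' ω = 0 ∨ Y' ω = 1)
    (h_bin_D1 : ∀ ω, D1 ω = 0 ∨ D1 ω = 1)
    (h_bin_D0 : ∀ ω, D0 ω = 0 ∨ D0 ω = 1)
    (h_bin_Y1 : ∀ ω, Y1 ω = 0 ∨ Y1 ω = 1)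
    (h_bin_Y0 : ∀ ω, Y0 ω = 0 ∨ Y0 ω = 1)
    (h_consD : ∀ ω, D ω = Z ω * D1 ω + (1 - Z ω) * D0 ω)
    (h_consY : ∀ ω, Y ω = Z ω * Y1 ω + (1 - Z ω) * Y0 ω)
    (h_indep : IndepFun Z (fun ω => (Y1 ω, Y0 ω, D1 ω, D0 ω)) μ)
    (h_mono : ∀ᵐ ω ∂μ, D0 ω ≤ D1 ω)
    (h_exclA : cpr μ {ω | D1 ω = 1 ∧ D0 ω = 1} {ω | Y1 ω = 1}
        = cpr μ {ω | D1 ω = 1 ∧ D0 ω = 1} {ω | Y0 ω = 1})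
    (h_exclN : cpr μ {ω | D1 ω = 0 ∧ D0 ω = 0} {ω | Y1 ω = 1}
        = cpr μ {ω | D1 ω = 0 ∧ D0 ω = 0} {ω | Y0 ω = 1})
    (h_strmono : ∀ᵐ ω ∂μ, D0 ω = 0)
    (h_ndY : ∀ y ∈ bin01, ∀ y' ∈ bin01, ∀ z ∈ bin01, ∀ d1 ∈ bin01, ∀ d0 ∈ bin01, ∀ y1 ∈ bin01, ∀ y0 ∈ bin01,
      μ ({ω | Y ω = y} ∩ {ω | Z ω = z} ∩ {ω | D1 ω = d1} ∩ {ω | D0 ω = d0} ∩ {ω | Y1 ω = y1} ∩ {ω | Y0 ω = y0}) ≠ 0 →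
      cpr μ ({ω | Y ω = y} ∩ {ω | Z ω = z} ∩ {ω | D1 ω = d1} ∩ {ω | D0 ω = d0} ∩ {ω | Y1 ω = y1} ∩ {ω | Y0 ω = y0}) {ω | Y' ω = y'}
        = cpr μ {ω | Y ω = y} {ω | Y' ω = y'})
    (h_posDZ1 : ∀ d ∈ bin01, μ ({ω | D ω = d} ∩ {ω | Z ω = 1}) ≠ 0)
    (h_posZ0 : μ {ω | Z ω = 0} ≠ 0)
    (h_posY : ∀ y ∈ bin01, μ {ω | Y ω = y} ≠ 0)
    (h_Uc : 0 < pr μ {ω | D1 ω = 1 ∧ D0 ω = 0})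
    (h_Un : 0 < pr μ {ω | D1 ω = 0 ∧ D0 ω = 0})
    (SNY SPY : ℝ)
    (h_SNY : SNY = cpr μ {ω | Y ω = 1} {ω | Y' ω = 1})
    (h_SPY : SPY = cpr μ {ω | Y ω = 0} {ω | Y' ω = 0})
    (h_rY : 0 < SNY + SPY - 1)
    (CACE CACE' MYm NYm : ℝ)
    (h_CACE : CACE = ∫ ω, (Y1 ω - Y0 ω) ∂(ProbabilityTheory.cond μ {ω | D1 ω = 1 ∧ D0 ω = 0}))
    (h_CACE' : CACE' = (cpr μ {ω | Z ω = 1} {ω | Y' ω = 1} - cpr μ {ω | Z ω = 0} {ω | Y' ω = 1})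
        / cpr μ {ω | Z ω = 1} {ω | D ω = 1})
    (h_CACE'_nonneg : 0 ≤ CACE')
    (h_NYm : NYm = min (cpr μ ({ω | D ω = 0} ∩ {ω | Z ω = 1}) {ω | Y' ω = 1}) (cpr μ ({ω | D ω = 1} ∩ {ω | Z ω = 1}) {ω | Y' ω = 1} - CACE'))
    (h_MYm : MYm = max (cpr μ ({ω | D ω = 0} ∩ {ω | Z ω = 1}) {ω | Y' ω = 1}) (cpr μ ({ω | D ω = 1} ∩ {ω | Z ω = 1}) {ω | Y' ω = 1})) :
    1 - NYm ≤ SPY ∧ MYm ≤ SNY ∧ CACE' ≤ CACE ∧ CACE * (MYm - NYm) ≤ CACE' := by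
  have m1 : ∀ {X : Ω → ℝ}, Measurable X → ∀ x, MeasurableSet {ω | X ω = x} :=
    fun hX x => hX (measurableSet_singleton x)
  have h0 : (0 : ℝ) ∈ bin01 := by simp [bin01]
  have h1 : (1 : ℝ) ∈ bin01 := by simp [bin01]
  have hscale : ∀ y ∈ bin01, ∀ z ∈ bin01, ∀ d ∈ bin01,
      μ.real ({ω | Y ω = y} ∩ {ω | Z ω = z} ∩ {ω | D1 ω = d} ∩ {ω | Y' ω = 1})
        = cpr μ {ω | Y ω = y} {ω | Y' ω = 1}
          * μ.real ({ω | Y ω = y} ∩ {ω | Z ω = z} ∩ {ω | D1 ω = d}) := by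
    intro y hy z hz d hd
    refine measureReal_inter_eq_mul_of_binary μ h_meas_D0 h_bin_D0 fun d0 hd0 => ?_
    refine measureReal_inter_eq_mul_of_binary μ h_meas_Y1 h_bin_Y1 fun y1 hy1 => ?_
    refine measureReal_inter_eq_mul_of_binary μ h_meas_Y0 h_bin_Y0 fun y0 hy0 => ?_
    have hmeas := (((((m1 h_meas_Y y).inter (m1 h_meas_Z z)).inter (m1 h_meas_D1 d)).inter
      (m1 h_meas_D0 d0)).inter (m1 h_meas_Y1 y1)).inter (m1 h_meas_Y0 y0)
    have hnd := h_ndY y hy 1 h1 z hz d hd d0 hd0 y1 hy1 y0 hy0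
    generalize {ω | Y ω = y} ∩ {ω | Z ω = z} ∩ {ω | D1 ω = d} ∩ {ω | D0 ω = d0}
      ∩ {ω | Y1 ω = y1} ∩ {ω | Y0 ω = y0} = A at hmeas hnd ⊢
    by_cases hA : μ A = 0
    · rw [measureReal_def, measureReal_def, hA, measure_mono_null Set.inter_subset_left hA]
      simp
    · have hA' : μ.real A ≠ 0 := (measureReal_ne_zero_iff).2 hA
      rw [← hnd hA, cpr_eq_div μ hmeas, div_mul_cancel₀ _ hA']
  have hbin_Y : ∀ ω, Y ω = 0 ∨ Y ω = 1 := by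
    intro ω
    rw [h_consY]
    rcases h_bin_Z ω with h | h <;> simp [h, h_bin_Y0 ω, h_bin_Y1 ω]
  have hFPR : cpr μ {ω | Y ω = 0} {ω | Y' ω = 1} = 1 - SPY := by
    have hpos : μ.real {ω | Y ω = 0} ≠ 0 := (measureReal_ne_zero_iff).2 (h_posY 0 h0)
    rw [h_SPY, cpr_eq_div μ (m1 h_meas_Y 0), cpr_eq_div μ (m1 h_meas_Y 0), eq_sub_iff_add_eq,
      ← add_div, div_eq_one_iff_eq hpos, add_comm]
    exact (measureReal_eq_add_of_binary μ h_meas_Yp h_bin_Yp _).symm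
  have hindep : ∀ (z : ℝ) {T : Set (ℝ × ℝ × ℝ × ℝ)}, MeasurableSet T →
      μ.real ({ω | Z ω = z} ∩ {ω | (Y1 ω, Y0 ω, D1 ω, D0 ω) ∈ T})
        = μ.real {ω | Z ω = z} * μ.real {ω | (Y1 ω, Y0 ω, D1 ω, D0 ω) ∈ T} := by
    intro z T hT
    have := h_indep.measure_inter_preimage_eq_mul {z} T (measurableSet_singleton z) hT
    simp only [measureReal_def, ← ENNReal.toReal_mul]
    exact congrArg ENNReal.toReal this
  have hZD : ∀ z d, μ.real ({ω | Z ω = z} ∩ {ω | D1 ω = d})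
      = μ.real {ω | Z ω = z} * μ.real {ω | D1 ω = d} := fun z d =>
    hindep z (T := {t | t.2.2.1 = d})
      ((by fun_prop : Measurable fun t : ℝ × ℝ × ℝ × ℝ => t.2.2.1) (measurableSet_singleton d))
  have hjoint : ∀ z ∈ bin01, ∀ d ∈ bin01, ∀ W : Ω → ℝ, (∀ ω, Z ω = z → Y ω = W ω) →
      (μ.real ({ω | Z ω = z} ∩ ({ω | D1 ω = d} ∩ {ω | W ω = 1}))
        = μ.real {ω | Z ω = z} * μ.real ({ω | D1 ω = d} ∩ {ω | W ω = 1})) →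
      μ.real ({ω | Z ω = z} ∩ {ω | D1 ω = d} ∩ {ω | Y' ω = 1})
        = μ.real {ω | Z ω = z} * ((1 - SPY) * μ.real {ω | D1 ω = d}
          + (SNY - (1 - SPY)) * μ.real ({ω | D1 ω = d} ∩ {ω | W ω = 1})) := by
    intro z hz d hd W hW hmul
    have hpos : μ.real ({ω | Y ω = 1} ∩ {ω | Z ω = z} ∩ {ω | D1 ω = d})
        = μ.real {ω | Z ω = z} * μ.real ({ω | D1 ω = d} ∩ {ω | W ω = 1}) := by
      rw [← hmul]
      congr 1
      ext ω
      have := hW ω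
      simp only [Set.mem_inter_iff, Set.mem_ofPred_eq]
      clear * - this
      grind
    have htot := measureReal_eq_add_of_binary μ h_meas_Y hbin_Y
      ({ω | Z ω = z} ∩ {ω | D1 ω = d})
    have htot' := measureReal_eq_add_of_binary μ h_meas_Y hbin_Y
      ({ω | Z ω = z} ∩ {ω | D1 ω = d} ∩ {ω | Y' ω = 1})
    have hs0 := hscale 0 h0 z hz d hd
    have hs1 := hscale 1 h1 z hz d hd
    have hcomm : ∀ y, {ω | Z ω = z} ∩ {ω | D1 ω = d} ∩ {ω | Y ω = y}
        = {ω | Y ω = y} ∩ {ω | Z ω = z} ∩ {ω | D1 ω = d} := fun y => by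
      rw [Set.inter_comm, Set.inter_assoc]
    rw [Set.inter_right_comm _ _ {ω | Y ω = 0}, Set.inter_right_comm _ _ {ω | Y ω = 1}, hcomm, hcomm, hs0, hs1,
      hFPR, ← h_SNY] at htot'
    rw [hcomm, hcomm, hZD] at htot
    rw [hpos] at htot htot'
    rw [htot']
    linear_combination -(1 - SPY) * htot
  have hjoint1 := fun d hd => hjoint 1 h1 d hd Y1 (fun ω hω => by simp [h_consY, hω])
    (hindep 1 (T := {t | t.2.2.1 = d} ∩ {t | t.1 = 1})
      (((by fun_prop : Measurable fun t : ℝ × ℝ × ℝ × ℝ => t.2.2.1)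
        (measurableSet_singleton d)).inter (measurable_fst (measurableSet_singleton 1))))
  have hjoint0 := fun d hd => hjoint 0 h0 d hd Y0 (fun ω hω => by simp [h_consY, hω])
    (hindep 0 (T := {t | t.2.2.1 = d} ∩ {t | t.2.1 = 1})
      (((by fun_prop : Measurable fun t : ℝ × ℝ × ℝ × ℝ => t.2.2.1)
        (measurableSet_singleton d)).inter
        ((by fun_prop : Measurable fun t : ℝ × ℝ × ℝ × ℝ => t.2.1) (measurableSet_singleton 1))))
  have hstratum : ∀ d, {ω | D1 ω = d ∧ D0 ω = 0} =ᵐ[μ] {ω | D1 ω = d} := by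
    intro d
    filter_upwards [h_strmono] with ω hω
    exact propext ⟨fun h => h.1, fun h => ⟨h, hω⟩⟩
  have hq : 0 < μ.real {ω | D1 ω = 0} := by
    rw [measureReal_def, ← measure_congr (hstratum 0)]
    exact h_Un
  have hp : 0 < μ.real {ω | D1 ω = 1} := by
    rw [measureReal_def, ← measure_congr (hstratum 1)]
    exact h_Uc
  have hexcl : μ.real ({ω | D1 ω = 0} ∩ {ω | Y1 ω = 1})
      = μ.real ({ω | D1 ω = 0} ∩ {ω | Y0 ω = 1}) := by
    rw [cpr_congr_ae μ (hstratum 0), cpr_congr_ae μ (hstratum 0),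
      cpr_eq_div μ (m1 h_meas_D1 0), cpr_eq_div μ (m1 h_meas_D1 0)] at h_exclN
    exact (div_left_inj' hq.ne').1 h_exclN
  have hDset : ∀ d, {ω | D ω = d} ∩ {ω | Z ω = 1} = {ω | Z ω = 1} ∩ {ω | D1 ω = d} := by
    intro d
    ext ω
    have hD : Z ω = 1 → D ω = D1 ω := fun h => by simp [h_consD, h]
    simp only [Set.mem_inter_iff, Set.mem_ofPred_eq]
    clear * - hD
    grind
  have hz1 : μ.real {ω | Z ω = 1} ≠ 0 := (measureReal_ne_zero_iff).2 fun h =>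
    h_posDZ1 1 h1 (measure_mono_null Set.inter_subset_right h)
  have hz0 : μ.real {ω | Z ω = 0} ≠ 0 := (measureReal_ne_zero_iff).2 h_posZ0
  have hcell : ∀ d ∈ bin01, μ.real {ω | D1 ω = d} ≠ 0 →
      cpr μ ({ω | D ω = d} ∩ {ω | Z ω = 1}) {ω | Y' ω = 1} = (1 - SPY) + (SNY - (1 - SPY))
        * (μ.real ({ω | D1 ω = d} ∩ {ω | Y1 ω = 1}) / μ.real {ω | D1 ω = d}) := by
    intro d hd hne
    rw [hDset, cpr_eq_div μ ((m1 h_meas_Z 1).inter (m1 h_meas_D1 d)), hjoint1 d hd, hZD]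
    field_simp
  have harm : ∀ z, cpr μ {ω | Z ω = z} {ω | Y' ω = 1}
      = (μ.real ({ω | Z ω = z} ∩ {ω | D1 ω = 0} ∩ {ω | Y' ω = 1})
        + μ.real ({ω | Z ω = z} ∩ {ω | D1 ω = 1} ∩ {ω | Y' ω = 1})) / μ.real {ω | Z ω = z} := by
    intro z
    rw [cpr_eq_div μ (m1 h_meas_Z z), measureReal_eq_add_of_binary μ h_meas_D1 h_bin_D1,
      Set.inter_right_comm, Set.inter_right_comm _ _ {ω | D1 ω = 1}]
  have htreat : cpr μ {ω | Z ω = 1} {ω | D ω = 1} = μ.real {ω | D1 ω = 1} := by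
    rw [cpr_eq_div μ (m1 h_meas_Z 1), Set.inter_comm, hDset, hZD, mul_div_cancel_left₀ _ hz1]
  have hcace : CACE = μ.real ({ω | D1 ω = 1} ∩ {ω | Y1 ω = 1}) / μ.real {ω | D1 ω = 1}
      - μ.real ({ω | D1 ω = 1} ∩ {ω | Y0 ω = 1}) / μ.real {ω | D1 ω = 1} := by
    rw [h_CACE, integral_sub (integrable_binary _ h_meas_Y1 h_bin_Y1)
      (integrable_binary _ h_meas_Y0 h_bin_Y0), integral_binary _ h_meas_Y1 h_bin_Y1,
      integral_binary _ h_meas_Y0 h_bin_Y0, ← cpr_eq_div μ (m1 h_meas_D1 1),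
      ← cpr_eq_div μ (m1 h_meas_D1 1), ← cpr_congr_ae μ (hstratum 1),
      ← cpr_congr_ae μ (hstratum 1)]
    rfl
  have hcace' : CACE' = (SNY - (1 - SPY)) * CACE := by
    rw [h_CACE', hcace, htreat, harm, harm, hjoint1 0 h0, hjoint1 1 h1, hjoint0 0 h0,
      hjoint0 1 h1, hexcl]
    field_simp
    ring
  rw [hcell 0 h0 hq.ne', hcell 1 h1 hp.ne'] at h_NYm h_MYm
  have hSNY : SNY ≤ 1 := by
    rw [h_SNY, cpr, ← measureReal_def]
    exact measureReal_le_one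
  obtain ⟨hN, hM, hle, hmul⟩ := cace_bounds hp hq hSNY
    (hFPR ▸ ENNReal.toReal_nonneg) (by linarith)
    (measureReal_mono Set.inter_subset_left) measureReal_nonneg measureReal_nonneg
    (measureReal_mono Set.inter_subset_left) hcace hcace' h_CACE'_nonneg h_NYm h_MYm
  exact ⟨by linarith, hM, hle, hmul⟩
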